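/- Let n ≥ 1, −n < a < +∞, 1 ≤ p < +∞ and C_n > 0, and suppose u ∈ C(cl(ℝⁿ₊)) is a nonnegative solution of u(x) = ∫_{ℝⁿ₊} G⁺(x,y) |y|^a u(y)^p dy on ℝⁿ₊. For λ > 0 set u_λ(x) := u(λ²x/|x|²) and ω^λ := u_λ − u. Then for every x ∈ B⁺_λ(0) := B_λ(0) ∩ ℝⁿ₊, ω^λ(x) = ∫_{B⁺_λ(0)} (G⁺(x,y) − G⁺(x,y^λ)) |y|^a ((λ/|y|)^{2(n+a)} u_λ(y)^p − u(y)^p) dy, where y^λ := λ² y/|y|². -/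

import Mathlib

open MeasureTheory Real Set Metric

noncomputable section

abbrev E (n : ℕ) := EuclideanSpace ℝ (Fin n)

/-- The last coordinate `xₙ` of a point `x ∈ ℝⁿ` (junk value `0` when `n = 0`). -/
def lastCoord (n : ℕ) (x : E n) : ℝ :=
  if h : 0 < n then x ⟨n - 1, Nat.sub_lt h Nat.one_pos⟩ else 0

/-- The upper half space `ℝⁿ₊ = {x : xₙ > 0}`. -/
def halfSpace (n : ℕ) : Set (E n) := {x | 0 < lastCoord n x}

/-- The last standard basis vector `eₙ`. -/
def lastBasis (n : ℕ) : E n :=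
  if h : 0 < n then EuclideanSpace.single ⟨n - 1, Nat.sub_lt h Nat.one_pos⟩ (1 : ℝ) else 0

/-- The reflection `x̄ = (x₁, …, x_{n−1}, −xₙ)` of `x` across `∂ℝⁿ₊`. -/
def reflect (n : ℕ) (x : E n) : E n := x - (2 * lastCoord n x) • lastBasis n

/-- The kernel `G⁺(x,y) = C_n (ln(1/|x−y|) − ln(1/|x̄−y|))`, the Green function of
`(−Δ)^{n/2}` on the half space with Navier boundary conditions. -/
def Gplus (n : ℕ) (Cn : ℝ) (x y : E n) : ℝ :=
  Cn * (Real.log (1 / ‖x - y‖) - Real.log (1 / ‖reflect n x - y‖))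

/-- The Laplacian `Δu = ∑ᵢ ∂²u/∂xᵢ²`. -/
def lap (n : ℕ) (u : E n → ℝ) (x : E n) : ℝ :=
  ∑ i, fderiv ℝ (fun y => fderiv ℝ u y (EuclideanSpace.single i 1)) x
    (EuclideanSpace.single i 1)

/-- The iterate `(−Δ)^k u` of the negative Laplacian. -/
def negLapIter (n k : ℕ) (u : E n → ℝ) : E n → ℝ :=
  (fun v x => - lap n v x)^[k] u

open EuclideanGeometry in
theorem inversion_zero_eq_smul {V : Type*} [NormedAddCommGroup V] [InnerProductSpace ℝ V]
    (R : ℝ) (x : V) : inversion (0 : V) R x = (R ^ 2 / ‖x‖ ^ 2) • x := by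
  simp [inversion, div_pow]

open EuclideanGeometry in
theorem norm_inversion_zero {V : Type*} [NormedAddCommGroup V] [InnerProductSpace ℝ V]
    (R : ℝ) (x : V) : ‖inversion (0 : V) R x‖ = R ^ 2 / ‖x‖ := by
  simpa using dist_inversion_center (0 : V) x R

open EuclideanGeometry in
theorem norm_inversion_sub_inversion_zero {V : Type*} [NormedAddCommGroup V]
    [InnerProductSpace ℝ V] {x y : V} (hx : x ≠ 0) (hy : y ≠ 0) (R : ℝ) :
    ‖inversion (0 : V) R x - inversion (0 : V) R y‖ = R ^ 2 / (‖x‖ * ‖y‖) * ‖x - y‖ := by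
  simpa [dist_eq_norm] using dist_inversion_inversion hx hy R

theorem abs_det_smul_reflection {V : Type*} [NormedAddCommGroup V] [InnerProductSpace ℝ V]
    [FiniteDimensional ℝ V] (K : Submodule ℝ V) (c : ℝ) :
    |(c • (K.reflection : V →L[ℝ] V)).det| = |c| ^ Module.finrank ℝ V := by
  have h : (c • (K.reflection : V →L[ℝ] V)).det =
      c ^ Module.finrank ℝ V * LinearMap.det K.reflection.toLinearMap :=
    LinearMap.det_smul c K.reflection.toLinearMap
  rw [h, K.det_reflection]
  simp [abs_mul, abs_pow]

/-- A power `‖y‖ ^ s` with `s` larger than minus the dimension is integrable on balls. -/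
theorem integrableOn_ball_norm_rpow {V : Type*} [NormedAddCommGroup V] [NormedSpace ℝ V]
    [FiniteDimensional ℝ V] [Nontrivial V] [MeasurableSpace V] [BorelSpace V]
    (μ : Measure V) [μ.IsAddHaarMeasure] {s : ℝ} (hs : -(Module.finrank ℝ V : ℝ) < s) (R : ℝ) :
    IntegrableOn (fun y : V => ‖y‖ ^ s) (ball 0 R) μ := by
  rcases le_or_gt R 0 with hR | hR
  · simp [ball_eq_empty.2 hR]
  have hd : 1 ≤ Module.finrank ℝ V := Module.finrank_pos
  refine (integrableOn_fun_norm_addHaar μ (f := fun r => r ^ s)).2 ?_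
  have h : -1 < ((Module.finrank ℝ V - 1 : ℕ) : ℝ) + s := by
    push_cast [hd]; linarith
  refine ((intervalIntegral.integrableOn_Ioo_rpow_iff hR).2 h).congr_fun (fun r hr => ?_)
    measurableSet_Ioo
  simp only [smul_eq_mul]
  rw [Real.rpow_add hr.1, Real.rpow_natCast]

section HalfSpace

variable {n : ℕ}

theorem lastCoord_eq_inner (x : E n) : lastCoord n x = inner ℝ (lastBasis n) x := by
  unfold lastCoord lastBasis
  split_ifs <;> simp [EuclideanSpace.inner_single_left]

theorem norm_lastBasis (hn : 1 ≤ n) : ‖lastBasis n‖ = 1 := by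
  have : 0 < n := hn
  simp [lastBasis, this]

theorem lastCoord_smul (c : ℝ) (x : E n) : lastCoord n (c • x) = c * lastCoord n x := by
  simp only [lastCoord_eq_inner, inner_smul_right]

theorem continuous_lastCoord : Continuous (lastCoord n) := by
  simp_rw [funext (lastCoord_eq_inner (n := n))]
  fun_prop

theorem isOpen_halfSpace : IsOpen (halfSpace n) :=
  isOpen_lt continuous_const continuous_lastCoord

theorem ne_zero_of_mem_halfSpace {x : E n} (hx : x ∈ halfSpace n) : x ≠ 0 := by
  rintro rfl
  have : (0 : ℝ) < lastCoord n 0 := hx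
  simp [lastCoord_eq_inner] at this

theorem norm_reflect_sub_sq (hn : 1 ≤ n) (x y : E n) :
    ‖reflect n x - y‖ ^ 2 = ‖x - y‖ ^ 2 + 4 * lastCoord n x * lastCoord n y := by
  have h1 : reflect n x - y = (x - y) - (2 * lastCoord n x) • lastBasis n := by
    unfold reflect; abel
  rw [h1, norm_sub_sq_real, inner_smul_right, norm_smul, norm_lastBasis hn, real_inner_comm,
    inner_sub_right, ← lastCoord_eq_inner, ← lastCoord_eq_inner, mul_one, Real.norm_eq_abs, sq_abs]
  ring

theorem norm_reflect (hn : 1 ≤ n) (x : E n) : ‖reflect n x‖ = ‖x‖ := by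
  have h := norm_reflect_sub_sq hn x 0
  simp only [sub_zero, lastCoord_eq_inner (0 : E n), inner_zero_right, mul_zero, add_zero] at h
  exact (pow_left_inj₀ (norm_nonneg _) (norm_nonneg _) two_ne_zero).1 h

theorem reflect_smul (c : ℝ) (x : E n) : reflect n (c • x) = c • reflect n x := by
  simp only [reflect, lastCoord_smul, smul_sub, smul_smul]
  congr 2; ring

theorem norm_sub_le_norm_reflect_sub (hn : 1 ≤ n) {x y : E n} (hx : x ∈ halfSpace n)
    (hy : y ∈ halfSpace n) : ‖x - y‖ ≤ ‖reflect n x - y‖ := by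
  have h := norm_reflect_sub_sq hn x y
  have : 0 < lastCoord n x * lastCoord n y := mul_pos hx hy
  exact le_of_sq_le_sq (by nlinarith) (norm_nonneg _)

theorem norm_reflect_sub_pos (hn : 1 ≤ n) {x y : E n} (hx : x ∈ halfSpace n)
    (hy : y ∈ halfSpace n) : 0 < ‖reflect n x - y‖ := by
  have h := norm_reflect_sub_sq hn x y
  have : 0 < lastCoord n x * lastCoord n y := mul_pos hx hy
  refine (norm_nonneg _).lt_of_ne' fun h0 => ?_
  rw [h0] at h
  nlinarith [sq_nonneg ‖x - y‖]

theorem Gplus_eq_log_div (hn : 1 ≤ n) (Cn : ℝ) {x y : E n} (hx : x ∈ halfSpace n)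
    (hy : y ∈ halfSpace n) (hxy : x ≠ y) :
    Gplus n Cn x y = Cn * Real.log (‖reflect n x - y‖ / ‖x - y‖) := by
  have h1 : ‖x - y‖ ≠ 0 := norm_ne_zero_iff.2 (sub_ne_zero.2 hxy)
  rw [Gplus, Real.log_div (norm_reflect_sub_pos hn hx hy).ne' h1]
  simp only [one_div, Real.log_inv]
  ring

theorem Gplus_eq_log_one_add (hn : 1 ≤ n) (Cn : ℝ) {x y : E n} (hx : x ∈ halfSpace n)
    (hy : y ∈ halfSpace n) (hxy : x ≠ y) :
    Gplus n Cn x y =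
      Cn / 2 * Real.log (1 + 4 * lastCoord n x * lastCoord n y / ‖x - y‖ ^ 2) := by
  have h1 : ‖x - y‖ ≠ 0 := norm_ne_zero_iff.2 (sub_ne_zero.2 hxy)
  have h2 : 1 + 4 * lastCoord n x * lastCoord n y / ‖x - y‖ ^ 2 =
      (‖reflect n x - y‖ / ‖x - y‖) ^ 2 := by
    rw [div_pow, norm_reflect_sub_sq hn]
    field_simp
  rw [Gplus_eq_log_div hn Cn hx hy hxy, h2, Real.log_pow]
  push_cast
  ring

theorem Gplus_nonneg (hn : 1 ≤ n) {Cn : ℝ} (hCn : 0 < Cn) {x y : E n} (hx : x ∈ halfSpace n)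
    (hy : y ∈ halfSpace n) (hxy : x ≠ y) : 0 ≤ Gplus n Cn x y := by
  rw [Gplus_eq_log_div hn Cn hx hy hxy]
  refine mul_nonneg hCn.le (Real.log_nonneg ?_)
  rw [one_le_div (norm_pos_iff.2 (sub_ne_zero.2 hxy))]
  exact norm_sub_le_norm_reflect_sub hn hx hy

open EuclideanGeometry in
theorem inversion_mem_halfSpace {lam : ℝ} (hlam : 0 < lam) {x : E n} (hx : x ∈ halfSpace n) :
    inversion (0 : E n) lam x ∈ halfSpace n := by
  have h0 : 0 < ‖x‖ := norm_pos_iff.2 (ne_zero_of_mem_halfSpace hx)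
  have hx' : 0 < lastCoord n x := hx
  rw [inversion_zero_eq_smul]
  change 0 < lastCoord n _
  rw [lastCoord_smul]
  positivity

open EuclideanGeometry in
theorem reflect_inversion (hn : 1 ≤ n) (lam : ℝ) (x : E n) :
    reflect n (inversion (0 : E n) lam x) = inversion (0 : E n) lam (reflect n x) := by
  rw [inversion_zero_eq_smul, inversion_zero_eq_smul, reflect_smul, norm_reflect hn]

open EuclideanGeometry in
/-- Conformal invariance of the Green function under inversion centred at the boundary. -/
theorem Gplus_inversion_inversion (hn : 1 ≤ n) (Cn : ℝ) {lam : ℝ} (hlam : 0 < lam) {x y : E n}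
    (hx : x ∈ halfSpace n) (hy : y ∈ halfSpace n) (hxy : x ≠ y) :
    Gplus n Cn (inversion (0 : E n) lam x) (inversion (0 : E n) lam y) = Gplus n Cn x y := by
  have hx0 := ne_zero_of_mem_halfSpace hx
  have hy0 := ne_zero_of_mem_halfSpace hy
  have hr0 : reflect n x ≠ 0 := by rwa [← norm_ne_zero_iff, norm_reflect hn, norm_ne_zero_iff]
  have hx1 : 0 < ‖x‖ := norm_pos_iff.2 hx0
  have hy1 : 0 < ‖y‖ := norm_pos_iff.2 hy0
  rw [Gplus_eq_log_div hn Cn hx hy hxy, Gplus_eq_log_div hn Cn (inversion_mem_halfSpace hlam hx)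
    (inversion_mem_halfSpace hlam hy) ((inversion_injective 0 hlam.ne').ne hxy),
    reflect_inversion hn, norm_inversion_sub_inversion_zero hx0 hy0,
    norm_inversion_sub_inversion_zero hr0 hy0, norm_reflect hn, mul_div_mul_left]
  positivity

end HalfSpace

section Integrability

variable {n : ℕ}

theorem measurable_Gplus (Cn : ℝ) (x : E n) : Measurable (Gplus n Cn x) := by
  unfold Gplus
  fun_prop

theorem integrableOn_ball_norm_sub_rpow (hn : 1 ≤ n) {s : ℝ} (hs : -(n : ℝ) < s) (x : E n)
    (R : ℝ) : IntegrableOn (fun y : E n => ‖x - y‖ ^ s) (ball 0 R) := by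
  have : Nonempty (Fin n) := ⟨⟨0, hn⟩⟩
  have h := integrableOn_ball_norm_rpow (volume : Measure (E n)) (s := s) (by simpa using hs)
    (‖x‖ + R)
  have hmp : MeasurePreserving (fun y : E n => x - y) volume volume :=
    Measure.measurePreserving_sub_left volume x
  rw [← hmp.integrableOn_comp_preimage (MeasurableEquiv.subLeft x).measurableEmbedding] at h
  refine h.mono_set fun y hy => ?_
  rw [mem_ball_zero_iff] at hy
  simp only [mem_preimage, mem_ball_zero_iff]
  linarith [norm_sub_le x y]

theorem rpow_le_add_rpow {r t s : ℝ} (hr : 0 < r) (hrt : r ≤ t) (hts : t ≤ s) (a : ℝ) :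
    t ^ a ≤ r ^ a + s ^ a := by
  have ht : 0 < t := hr.trans_le hrt
  have hs : 0 < s := ht.trans_le hts
  rcases le_total 0 a with h | h
  · linarith [Real.rpow_le_rpow ht.le hts h, Real.rpow_nonneg hr.le a]
  · linarith [Real.rpow_le_rpow_of_nonpos hr hrt h, Real.rpow_nonneg hs.le a]

theorem Gplus_le_rpow (hn : 1 ≤ n) {Cn : ℝ} (hCn : 0 < Cn) {x y : E n} (hx : x ∈ halfSpace n)
    (hy : y ∈ halfSpace n) (hxy : x ≠ y) {A : ℝ} (hA : ‖x‖ + ‖y‖ ≤ A) :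
    Gplus n Cn x y ≤ 2 * Cn * A ^ (1 / 2 : ℝ) * ‖x - y‖ ^ (-(1 / 2) : ℝ) := by
  have hd : 0 < ‖x - y‖ := norm_pos_iff.2 (sub_ne_zero.2 hxy)
  have hρ : 0 < ‖reflect n x - y‖ := norm_reflect_sub_pos hn hx hy
  have hρA : ‖reflect n x - y‖ ≤ A := by
    have := norm_sub_le (reflect n x) y
    rw [norm_reflect hn] at this
    linarith
  have hlog := Real.log_le_rpow_div (div_pos hρ hd).le (one_half_pos (α := ℝ))
  rw [Real.div_rpow hρ.le hd.le] at hlog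
  have hpow : ‖reflect n x - y‖ ^ (1 / 2 : ℝ) ≤ A ^ (1 / 2 : ℝ) :=
    Real.rpow_le_rpow hρ.le hρA (by norm_num)
  rw [Gplus_eq_log_div hn Cn hx hy hxy, Real.rpow_neg hd.le]
  calc Cn * Real.log (‖reflect n x - y‖ / ‖x - y‖)
      ≤ Cn * (A ^ (1 / 2 : ℝ) / ‖x - y‖ ^ (1 / 2 : ℝ) / (1 / 2)) := by
        refine mul_le_mul_of_nonneg_left (hlog.trans ?_) hCn.le
        gcongr
    _ = _ := by ring

theorem integrableOn_Gplus_mul_norm_rpow (hn : 1 ≤ n) {a Cn : ℝ} (ha : -(n : ℝ) < a)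
    (hCn : 0 < Cn) {x : E n} (hx : x ∈ halfSpace n) (R : ℝ) :
    IntegrableOn (fun y => Gplus n Cn x y * ‖y‖ ^ a) (ball 0 R ∩ halfSpace n) := by
  have : Nonempty (Fin n) := ⟨⟨0, hn⟩⟩
  have hn' : (1 : ℝ) ≤ n := by exact_mod_cast hn
  have hx0 : 0 < ‖x‖ := norm_pos_iff.2 (ne_zero_of_mem_halfSpace hx)
  set r := ‖x‖ / 2 with hr
  have hr0 : 0 < r := by positivity
  set K := 2 * Cn * (‖x‖ + R) ^ (1 / 2 : ℝ) with hK
  have hint : IntegrableOn (fun y : E n => K * (r ^ (-(1 / 2) : ℝ) * ‖y‖ ^ a +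
      (r ^ a + (3 * r) ^ a) * ‖x - y‖ ^ (-(1 / 2) : ℝ))) (ball 0 R ∩ halfSpace n) := by
    refine IntegrableOn.mono_set ?_ inter_subset_left
    have h1 := integrableOn_ball_norm_sub_rpow hn ha 0 R
    have h2 := integrableOn_ball_norm_sub_rpow hn (s := -(1 / 2)) (by linarith) x R
    simp only [zero_sub, norm_neg] at h1
    exact ((h1.const_mul _).add (h2.const_mul _)).const_mul _
  refine hint.mono' ?_ ?_
  · exact ((measurable_Gplus Cn x).mul (measurable_norm.pow_const a)).aestronglyMeasurable
  · filter_upwards [ae_restrict_mem (measurableSet_ball.inter isOpen_halfSpace.measurableSet),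
      ae_restrict_of_ae (Measure.ae_ne volume x)] with y hy hyx
    obtain ⟨hyR, hyH⟩ := hy
    rw [mem_ball_zero_iff] at hyR
    have hG := Gplus_le_rpow hn hCn hx hyH hyx.symm (A := ‖x‖ + R) (by linarith)
    have hd : 0 < ‖x - y‖ := norm_pos_iff.2 (sub_ne_zero.2 hyx.symm)
    have hya : 0 ≤ ‖y‖ ^ a := by positivity
    have hR : 0 < ‖x‖ + R := by linarith [norm_nonneg y]
    have hK0 : 0 ≤ K := by positivity
    rw [Real.norm_of_nonneg (mul_nonneg (Gplus_nonneg hn hCn hx hyH hyx.symm) hya)]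
    refine (mul_le_mul_of_nonneg_right hG hya).trans ?_
    rw [mul_assoc]
    refine mul_le_mul_of_nonneg_left ?_ hK0
    rcases le_or_gt r ‖x - y‖ with h | h
    · have h1 : ‖x - y‖ ^ (-(1 / 2) : ℝ) ≤ r ^ (-(1 / 2) : ℝ) :=
        Real.rpow_le_rpow_of_nonpos hr0 h (by norm_num)
      have h2 : 0 ≤ (r ^ a + (3 * r) ^ a) * ‖x - y‖ ^ (-(1 / 2) : ℝ) := by positivity
      linarith [mul_le_mul_of_nonneg_right h1 hya]
    · have h1 : ‖y‖ ^ a ≤ r ^ a + (3 * r) ^ a := by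
        refine rpow_le_add_rpow hr0 ?_ ?_ a
        · linarith [norm_sub_norm_le x y]
        · linarith [norm_sub_norm_le y x, norm_sub_rev x y]
      have h2 : 0 ≤ r ^ (-(1 / 2) : ℝ) * ‖y‖ ^ a := by positivity
      have h3 : 0 ≤ ‖x - y‖ ^ (-(1 / 2) : ℝ) := by positivity
      linarith [mul_le_mul_of_nonneg_left h1 h3]

theorem log_one_add_mul_le {k t : ℝ} (hk : 1 ≤ k) (ht : 0 ≤ t) :
    Real.log (1 + k * t) ≤ k * Real.log (1 + t) := by
  rw [← Real.log_rpow (by linarith)]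
  exact Real.log_le_log (by positivity) (one_add_mul_self_le_rpow_one_add (by linarith) hk)

/-- Away from the poles, Green functions with different poles are comparable. -/
theorem exists_Gplus_le_mul_Gplus (hn : 1 ≤ n) {Cn : ℝ} (hCn : 0 < Cn) {x z : E n}
    (hx : x ∈ halfSpace n) (hz : z ∈ halfSpace n) :
    ∃ k R : ℝ, 0 ≤ k ∧ ∀ y ∈ halfSpace n, R ≤ ‖y‖ → Gplus n Cn x y ≤ k * Gplus n Cn z y := by
  have hx0 : 0 < ‖x‖ := norm_pos_iff.2 (ne_zero_of_mem_halfSpace hx)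
  have hz0 : 0 < ‖z‖ := norm_pos_iff.2 (ne_zero_of_mem_halfSpace hz)
  have hxl : 0 < lastCoord n x := hx
  have hzl : 0 < lastCoord n z := hz
  set k := max 1 (9 * lastCoord n x / lastCoord n z) with hk
  have hk1 : 1 ≤ k := le_max_left _ _
  refine ⟨k, 2 * ‖x‖ + 2 * ‖z‖, by linarith, fun y hy hR => ?_⟩
  have hyl : 0 < lastCoord n y := hy
  have hy0 : 0 < ‖y‖ := by linarith
  have hdx : ‖y‖ / 2 ≤ ‖x - y‖ := by linarith [norm_sub_norm_le y x, norm_sub_rev x y]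
  have hdz : ‖z - y‖ ≤ 3 / 2 * ‖y‖ := by linarith [norm_sub_le z y]
  have hxy : x ≠ y := by rintro rfl; linarith
  have hzy : z ≠ y := by rintro rfl; linarith
  have hdx0 : 0 < ‖x - y‖ := norm_pos_iff.2 (sub_ne_zero.2 hxy)
  have hdz0 : 0 < ‖z - y‖ := norm_pos_iff.2 (sub_ne_zero.2 hzy)
  have hdist : ‖z - y‖ ^ 2 ≤ 9 * ‖x - y‖ ^ 2 := by nlinarith
  have hkl : 9 * lastCoord n x ≤ k * lastCoord n z :=
    (div_le_iff₀ hzl).1 (le_max_right _ _)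
  have hcmp : 4 * lastCoord n x * lastCoord n y / ‖x - y‖ ^ 2 ≤
      k * (4 * lastCoord n z * lastCoord n y / ‖z - y‖ ^ 2) := by
    rw [← mul_div_assoc, div_le_div_iff₀ (by positivity) (by positivity)]
    calc 4 * lastCoord n x * lastCoord n y * ‖z - y‖ ^ 2
        ≤ 4 * lastCoord n x * lastCoord n y * (9 * ‖x - y‖ ^ 2) := by gcongr
      _ = 4 * (9 * lastCoord n x) * lastCoord n y * ‖x - y‖ ^ 2 := by ring
      _ ≤ 4 * (k * lastCoord n z) * lastCoord n y * ‖x - y‖ ^ 2 := by gcongr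
      _ = _ := by ring
  rw [Gplus_eq_log_one_add hn Cn hx hy hxy, Gplus_eq_log_one_add hn Cn hz hy hzy]
  calc Cn / 2 * Real.log (1 + 4 * lastCoord n x * lastCoord n y / ‖x - y‖ ^ 2)
      ≤ Cn / 2 * Real.log (1 + k * (4 * lastCoord n z * lastCoord n y / ‖z - y‖ ^ 2)) := by
        gcongr
    _ ≤ Cn / 2 * (k * Real.log (1 + 4 * lastCoord n z * lastCoord n y / ‖z - y‖ ^ 2)) := by
        refine mul_le_mul_of_nonneg_left (log_one_add_mul_le hk1 ?_) (by positivity)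
        positivity
    _ = _ := by ring

variable {a p Cn : ℝ} {u : E n → ℝ}

theorem aestronglyMeasurable_Gplus_mul (hu : ContinuousOn u (closure (halfSpace n))) (x : E n) :
    AEStronglyMeasurable (fun y => Gplus n Cn x y * ‖y‖ ^ a * u y ^ p)
      (volume.restrict (halfSpace n)) := by
  have hum : AEMeasurable u (volume.restrict (halfSpace n)) :=
    (hu.mono subset_closure).aemeasurable isOpen_halfSpace.measurableSet
  exact (((measurable_Gplus Cn x).mul (measurable_norm.pow_const a)).aemeasurable.mul
    (hum.pow_const p)).aestronglyMeasurable

theorem integrableOn_Gplus_mul_of_integrableOn (hn : 1 ≤ n) (ha : -(n : ℝ) < a) (hp : 0 ≤ p)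
    (hCn : 0 < Cn) (hu : ContinuousOn u (closure (halfSpace n)))
    (hnonneg : ∀ x ∈ closure (halfSpace n), 0 ≤ u x) {x z : E n} (hx : x ∈ halfSpace n)
    (hz : z ∈ halfSpace n)
    (hint : IntegrableOn (fun y => Gplus n Cn z y * ‖y‖ ^ a * u y ^ p) (halfSpace n)) :
    IntegrableOn (fun y => Gplus n Cn x y * ‖y‖ ^ a * u y ^ p) (halfSpace n) := by
  have : Nonempty (Fin n) := ⟨⟨0, hn⟩⟩
  obtain ⟨k, R, hk, hkR⟩ := exists_Gplus_le_mul_Gplus hn hCn hx hz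
  have hsplit : halfSpace n = (ball 0 R ∩ halfSpace n) ∪ ((ball 0 R)ᶜ ∩ halfSpace n) := by
    rw [← union_inter_distrib_right, union_compl_self, univ_inter]
  have hmeas := aestronglyMeasurable_Gplus_mul (a := a) (p := p) (Cn := Cn) hu x
  rw [hsplit]
  refine IntegrableOn.union ?_ ?_
  · have hcpt : IsCompact (closedBall (0 : E n) R ∩ closure (halfSpace n)) :=
      (isCompact_closedBall _ _).inter_right isClosed_closure
    obtain ⟨M, hM⟩ := hcpt.exists_bound_of_continuousOn (hu.mono inter_subset_right)
    refine ((integrableOn_Gplus_mul_norm_rpow hn ha hCn hx R).norm.mul_const (M ^ p)).mono'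
      (hmeas.mono_set inter_subset_right) ?_
    filter_upwards [ae_restrict_mem (measurableSet_ball.inter isOpen_halfSpace.measurableSet)]
      with y hy
    have hyc := subset_closure hy.2
    have huM : u y ≤ M := (le_abs_self _).trans (hM y ⟨ball_subset_closedBall hy.1, hyc⟩)
    rw [norm_mul, Real.norm_of_nonneg (Real.rpow_nonneg (hnonneg y hyc) p)]
    exact mul_le_mul_of_nonneg_left (Real.rpow_le_rpow (hnonneg y hyc) huM hp) (norm_nonneg _)
  · refine ((hint.mono_set inter_subset_right).const_mul k).mono'
      (hmeas.mono_set inter_subset_right) ?_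
    filter_upwards [ae_restrict_mem
      (measurableSet_ball.compl.inter isOpen_halfSpace.measurableSet),
      ae_restrict_of_ae (Measure.ae_ne volume x)] with y hy hyx
    have hyR : R ≤ ‖y‖ := by simpa using hy.1
    have hup : 0 ≤ u y ^ p := Real.rpow_nonneg (hnonneg y (subset_closure hy.2)) p
    have hG := Gplus_nonneg hn hCn hx hy.2 hyx.symm
    rw [Real.norm_of_nonneg (by positivity), ← mul_assoc, ← mul_assoc]
    gcongr
    exact hkR y hy.2 hyR

/-- For a solution of the integral equation the integrand is integrable for every pole. -/
theorem integrableOn_Gplus_mul_of_solution (hn : 1 ≤ n) (ha : -(n : ℝ) < a) (hp : 0 < p)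
    (hCn : 0 < Cn) (hu : ContinuousOn u (closure (halfSpace n)))
    (hnonneg : ∀ x ∈ closure (halfSpace n), 0 ≤ u x)
    (hie : ∀ x ∈ halfSpace n,
      u x = ∫ y in halfSpace n, Gplus n Cn x y * ‖y‖ ^ a * u y ^ p)
    {x : E n} (hx : x ∈ halfSpace n) :
    IntegrableOn (fun y => Gplus n Cn x y * ‖y‖ ^ a * u y ^ p) (halfSpace n) := by
  by_contra hcon
  have hzero : ∀ z ∈ halfSpace n, u z = 0 := fun z hz => by
    rw [hie z hz]
    exact integral_undef fun h => hcon
      (integrableOn_Gplus_mul_of_integrableOn hn ha hp.le hCn hu hnonneg hx hz h)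
  refine hcon (integrableOn_zero.congr_fun (fun y hy => ?_) isOpen_halfSpace.measurableSet)
  simp [hzero y hy, Real.zero_rpow hp.ne']

end Integrability

section Inversion

open EuclideanGeometry

variable {n : ℕ}

theorem image_inversion_ball_inter_halfSpace {lam : ℝ} (hlam : 0 < lam) :
    inversion (0 : E n) lam '' (ball 0 lam ∩ halfSpace n) =
      (closedBall 0 lam)ᶜ ∩ halfSpace n := by
  have key : ∀ y ∈ halfSpace n, (‖inversion (0 : E n) lam y‖ < lam ↔ lam < ‖y‖) := fun y hy => by
    have hy0 : 0 < ‖y‖ := norm_pos_iff.2 (ne_zero_of_mem_halfSpace hy)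
    rw [norm_inversion_zero, div_lt_iff₀ hy0, sq, mul_lt_mul_iff_right₀ hlam]
  have hinv := inversion_inversion (0 : E n) hlam.ne'
  ext y
  simp only [mem_image, mem_inter_iff, mem_ball_zero_iff, mem_compl_iff, mem_closedBall_zero_iff,
    not_le]
  constructor
  · rintro ⟨z, ⟨hz, hzH⟩, rfl⟩
    have hH := inversion_mem_halfSpace hlam hzH
    refine ⟨(key _ hH).1 ?_, hH⟩
    rwa [hinv]
  · rintro ⟨hy, hyH⟩
    exact ⟨_, ⟨(key y hyH).2 hy, inversion_mem_halfSpace hlam hyH⟩, hinv y⟩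

/-- Folding an integral over the half space into the half ball by inversion. -/
theorem setIntegral_halfSpace_eq_ball_add_inversion (hn : 1 ≤ n) {lam : ℝ} (hlam : 0 < lam)
    {g : E n → ℝ} (hg : IntegrableOn g (halfSpace n)) :
    IntegrableOn (fun y => ((lam / ‖y‖) ^ 2) ^ n * g (inversion (0 : E n) lam y))
        (ball 0 lam ∩ halfSpace n) ∧
      ∫ y in halfSpace n, g y = (∫ y in ball 0 lam ∩ halfSpace n, g y) +
        ∫ y in ball 0 lam ∩ halfSpace n,
          ((lam / ‖y‖) ^ 2) ^ n * g (inversion (0 : E n) lam y) := by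
  have : Nonempty (Fin n) := ⟨⟨0, hn⟩⟩
  set S : Set (E n) := ball 0 lam ∩ halfSpace n
  have hS : MeasurableSet S := measurableSet_ball.inter isOpen_halfSpace.measurableSet
  have hS' : MeasurableSet ((closedBall (0 : E n) lam)ᶜ ∩ halfSpace n) :=
    measurableSet_closedBall.compl.inter isOpen_halfSpace.measurableSet
  have hderiv : ∀ y ∈ S, HasFDerivWithinAt (inversion (0 : E n) lam)
      ((lam / dist y 0) ^ 2 • ((Submodule.span ℝ {y - 0})ᗮ.reflection : E n →L[ℝ] E n)) S y :=
    fun y hy => (hasFDerivAt_inversion (ne_zero_of_mem_halfSpace hy.2)).hasFDerivWithinAt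
  have hinj : InjOn (inversion (0 : E n) lam) S := (inversion_injective 0 hlam.ne').injOn
  have hdet : ∀ y : E n, |((lam / dist y 0) ^ 2 •
      ((Submodule.span ℝ {y - 0})ᗮ.reflection : E n →L[ℝ] E n)).det| =
        ((lam / ‖y‖) ^ 2) ^ n := fun y => by
    rw [abs_det_smul_reflection, dist_zero_right, abs_of_nonneg (sq_nonneg _),
      finrank_euclideanSpace_fin]
  have hI := integrableOn_image_iff_integrableOn_abs_det_fderiv_smul volume hS hderiv hinj g
  have hE := integral_image_eq_integral_abs_det_fderiv_smul volume hS hderiv hinj g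
  simp only [hdet, smul_eq_mul] at hI hE
  rw [image_inversion_ball_inter_halfSpace hlam] at hI hE
  have hg' := hg.mono_set (inter_subset_right : (closedBall (0 : E n) lam)ᶜ ∩ halfSpace n ⊆ _)
  refine ⟨hI.1 hg', ?_⟩
  have hae : halfSpace n =ᵐ[volume] (S ∪ ((closedBall (0 : E n) lam)ᶜ ∩ halfSpace n) : Set _) := by
    have hsph : ∀ᵐ y : E n, y ∉ sphere (0 : E n) lam :=
      measure_eq_zero_iff_ae_notMem.1 (Measure.addHaar_sphere volume 0 lam)
    refine Filter.eventuallyEq_set.2 ?_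
    filter_upwards [hsph] with y hy
    simp only [mem_sphere_zero_iff_norm] at hy
    simp only [S, mem_union, mem_inter_iff, mem_ball_zero_iff, mem_compl_iff,
      mem_closedBall_zero_iff, not_le]
    have := lt_or_gt_of_ne hy
    tauto
  rw [setIntegral_congr_set hae, setIntegral_union ?_ hS' (hg.mono_set inter_subset_right) hg', hE]
  refine Set.disjoint_left.2 fun y hy hy' => hy'.1 (ball_subset_closedBall hy.1)

theorem pow_mul_norm_inversion_rpow {lam : ℝ} (hlam : 0 < lam) {y : E n} (hy : y ≠ 0) (a : ℝ) :
    ((lam / ‖y‖) ^ 2) ^ n * ‖inversion (0 : E n) lam y‖ ^ a =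
      ‖y‖ ^ a * (lam / ‖y‖) ^ (2 * ((n : ℝ) + a)) := by
  have hy0 : 0 < ‖y‖ := norm_pos_iff.2 hy
  have hq : 0 < lam / ‖y‖ := by positivity
  have h1 : ‖inversion (0 : E n) lam y‖ = ‖y‖ * (lam / ‖y‖) ^ 2 := by
    rw [norm_inversion_zero]
    field_simp
  rw [h1, Real.mul_rpow hy0.le (by positivity), Real.rpow_mul hq.le, Real.rpow_add (by positivity),
    Real.rpow_natCast, Real.rpow_two]
  ring

end Inversion

/-- **Integral representation of `ω^λ = u_λ − u` on the half ball** (formula (4.7) of the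
paper). If `u ∈ C(cl ℝⁿ₊)` is a nonnegative solution of
`u(x) = ∫_{ℝⁿ₊} G⁺(x,y)|y|^a u(y)^p dy`, then for every `λ > 0` and every
`x ∈ B⁺_λ(0) = B_λ(0) ∩ ℝⁿ₊`,
`ω^λ(x) = ∫_{B⁺_λ(0)} (G⁺(x,y) − G⁺(x,y^λ)) |y|^a ((λ/|y|)^{2(n+a)} u_λ(y)^p − u(y)^p) dy`,
where `u_λ(x) = u(λ²x/|x|²)` and `y^λ = λ²y/|y|²`. -/
theorem omega_representation (n : ℕ) (hn : 1 ≤ n) (a p Cn : ℝ)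
    (ha : -(n : ℝ) < a) (hp : 1 ≤ p) (hCn : 0 < Cn)
    (u : E n → ℝ)
    (hu : ContinuousOn u (closure (halfSpace n)))
    (hnonneg : ∀ x ∈ closure (halfSpace n), 0 ≤ u x)
    (hie : ∀ x ∈ halfSpace n,
      u x = ∫ y in halfSpace n, Gplus n Cn x y * ‖y‖ ^ a * u y ^ p) :
    ∀ lam : ℝ, 0 < lam → ∀ x ∈ Metric.ball (0 : E n) lam ∩ halfSpace n,
      u ((lam ^ 2 / ‖x‖ ^ 2) • x) - u x =
        ∫ y in Metric.ball (0 : E n) lam ∩ halfSpace n,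
          (Gplus n Cn x y - Gplus n Cn x ((lam ^ 2 / ‖y‖ ^ 2) • y)) * ‖y‖ ^ a *
            ((lam / ‖y‖) ^ (2 * ((n : ℝ) + a)) * u ((lam ^ 2 / ‖y‖ ^ 2) • y) ^ p -
              u y ^ p) := by
  intro lam hlam x hx
  have : Nonempty (Fin n) := ⟨⟨0, hn⟩⟩
  simp only [← inversion_zero_eq_smul]
  set I := EuclideanGeometry.inversion (0 : E n) lam with hIdef
  set S : Set (E n) := ball 0 lam ∩ halfSpace n
  have hS : MeasurableSet S := measurableSet_ball.inter isOpen_halfSpace.measurableSet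
  have hII : ∀ y, I (I y) = y := EuclideanGeometry.inversion_inversion (0 : E n) hlam.ne'
  have hIx : I x ∈ halfSpace n := inversion_mem_halfSpace hlam hx.2
  have hp0 : 0 < p := one_pos.trans_le hp
  have hix := integrableOn_Gplus_mul_of_solution hn ha hp0 hCn hu hnonneg hie hx.2
  have hiIx := integrableOn_Gplus_mul_of_solution hn ha hp0 hCn hu hnonneg hie hIx
  obtain ⟨hx1, hx2⟩ := setIntegral_halfSpace_eq_ball_add_inversion hn hlam hix
  obtain ⟨hx3, hx4⟩ := setIntegral_halfSpace_eq_ball_add_inversion hn hlam hiIx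
  have hx5 := hix.mono_set (inter_subset_right : S ⊆ _)
  have hx6 := hiIx.mono_set (inter_subset_right : S ⊆ _)
  rw [hie x hx.2, hie (I x) hIx, hx2, hx4, ← integral_add hx6 hx3, ← integral_add hx5 hx1]
  refine (integral_sub (hx6.add hx3) (hx5.add hx1)).symm.trans (integral_congr_ae ?_)
  filter_upwards [ae_restrict_mem hS, ae_restrict_of_ae (Measure.ae_ne volume x),
    ae_restrict_of_ae (Measure.ae_ne volume (I x))] with y hy hyx hyIx
  have hIy : I y ∈ halfSpace n := inversion_mem_halfSpace hlam hy.2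
  have h1 : Gplus n Cn (I x) (I y) = Gplus n Cn x y :=
    Gplus_inversion_inversion hn Cn hlam hx.2 hy.2 hyx.symm
  have h2 : Gplus n Cn (I x) y = Gplus n Cn x (I y) := by
    have := Gplus_inversion_inversion hn Cn hlam hx.2 hIy (fun h => hyIx (by rw [h, hII]))
    rwa [← hIdef, hII] at this
  have h3 := pow_mul_norm_inversion_rpow hlam (ne_zero_of_mem_halfSpace hy.2) a
  rw [← hIdef] at h3
  simp only [h1, h2, ← hIdef, Pi.add_apply]
  linear_combination (Gplus n Cn x y - Gplus n Cn x (I y)) * u (I y) ^ p * h3
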